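/- Frequency-localized bilinear estimate for rough potentials (core of Lemma 5.3, combining (est:I11) and (est:I12)): Let s ≥ 0, 2 ≤ p ≤ ∞, γ_p = 3/2 + 1/p, ε ∈ (0, 1/2), and β with 0 ≤ β < s + γ_p − ε. There exists a constant C > 0 such that for all real N₀ ≥ 1, all ξ̂ : ℤ → ℂ with ‖ξ̂‖_{b̂^{s,p}} < ∞, and all w : ℤ → ℂ with ‖w‖_{h^{s+γ_p−ε}} < ∞, one has ( Σ_{k∈ℤ, |k| ≤ N₀} ⟨k⟩^{2β} | Σ_{k₁+k₂=k} ξ̂_{k₁} w_{k₂} |² )^{1/2} ≤ C · max{ N₀^{β − s − 1/p + 1/2 + ε}, 1 } · ‖ξ̂‖_{b̂^{s,p}} · ‖w‖_{h^{s+γ_p−ε}}. -/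

import Mathlib

open scoped ENNReal

/-- The Japanese bracket `⟨k⟩ = (1 + k²)^{1/2}` of an integer `k`. -/
noncomputable def jbr (k : ℤ) : ℝ := Real.sqrt (1 + (k : ℝ) ^ 2)

/-- The `b̂^{s,p}` norm `|ξ̂_0| + ‖ |k|^s ξ̂_k ‖_{ℓ^p(k≠0)}` of a sequence of Fourier
coefficients, for `1 ≤ p ≤ ∞`. -/
noncomputable def bnorm (s : ℝ) (p : ℝ≥0∞) (ξ : ℤ → ℂ) : ℝ :=
  ‖ξ 0‖ +
    if p = ∞ then ⨆ k : ℤ, (if k = 0 then 0 else (|k| : ℝ) ^ s * ‖ξ k‖)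
    else (∑' k : ℤ, (if k = 0 then (0 : ℝ) else ((|k| : ℝ) ^ s * ‖ξ k‖) ^ p.toReal)) ^
      (1 / p.toReal)

open MeasureTheory

lemma one_le_jbr (k : ℤ) : 1 ≤ jbr k :=
  Real.one_le_sqrt.2 (by nlinarith [sq_nonneg (k : ℝ)])

lemma jbr_pos (k : ℤ) : 0 < jbr k := zero_lt_one.trans_le (one_le_jbr k)

lemma abs_le_jbr (k : ℤ) : |(k : ℝ)| ≤ jbr k :=
  Real.abs_le_sqrt (by linarith)

lemma jbr_le_two_mul {k : ℤ} {N : ℝ} (hN : 1 ≤ N) (hk : |(k : ℝ)| ≤ N) : jbr k ≤ 2 * N := by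
  refine Real.sqrt_le_iff.2 ⟨by linarith, ?_⟩
  nlinarith [sq_abs (k : ℝ), abs_nonneg (k : ℝ)]

lemma jbr_le_two_mul_abs {k : ℤ} (hk : k ≠ 0) : jbr k ≤ 2 * |(k : ℝ)| :=
  jbr_le_two_mul (by exact_mod_cast Int.one_le_abs hk) le_rfl

/-- Peetre's inequality for the Japanese bracket. -/
lemma jbr_add_le (k l : ℤ) : jbr (k + l) ≤ 2 * (jbr k * jbr l) := by
  unfold jbr
  rw [← Real.sqrt_mul (by positivity)]
  refine Real.sqrt_le_iff.2 ⟨by positivity, ?_⟩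
  rw [mul_pow, Real.sq_sqrt (by positivity)]
  push_cast
  nlinarith [sq_nonneg ((k : ℝ) - l), sq_nonneg ((k : ℝ) * l), sq_nonneg (k : ℝ),
    sq_nonneg (l : ℝ)]

lemma summable_jbr_rpow {t : ℝ} (ht : 1 < t) : Summable fun k : ℤ => jbr k ^ (-t) := by
  have h1 : Summable fun k : ℤ => |(k : ℝ)| ^ (-t) + (if k = 0 then (1 : ℝ) else 0) :=
    (Real.summable_abs_int_rpow ht).add
      (summable_of_ne_finset_zero (s := {0}) fun k hk => by simp_all)
  refine h1.of_nonneg_of_le (fun k => Real.rpow_nonneg (jbr_pos k).le _) fun k => ?_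
  by_cases hk : k = 0
  · subst hk
    have : (0 : ℝ) ≤ |((0 : ℤ) : ℝ)| ^ (-t) := by positivity
    simpa [jbr] using this
  · simp only [hk, if_false, add_zero]
    exact Real.rpow_le_rpow_of_nonpos (by positivity) (abs_le_jbr k) (by linarith)

lemma memLp_jbr_rpow {q : ℝ≥0∞} (hq : q ≠ 0) {δ : ℝ} (hδ : 0 ≤ δ)
    (h : q ≠ ∞ → 1 < δ * q.toReal) :
    MemLp (fun k : ℤ => jbr k ^ (-δ)) q Measure.count := by
  by_cases hq' : q = ∞
  · subst hq'
    refine memLp_top_of_bound (measurable_of_countable _).aestronglyMeasurable 1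
      (.of_forall fun k => ?_)
    rw [Real.norm_of_nonneg (Real.rpow_nonneg (jbr_pos k).le _)]
    exact Real.rpow_le_one_of_one_le_of_nonpos (one_le_jbr k) (by linarith)
  · rw [← integrable_norm_rpow_iff (measurable_of_countable _).aestronglyMeasurable hq hq',
      integrable_count_iff]
    refine (summable_jbr_rpow (h hq')).norm.congr fun k => ?_
    rw [Real.norm_of_nonneg (Real.rpow_nonneg (jbr_pos k).le (-δ)), ← Real.rpow_mul (jbr_pos k).le,
      neg_mul]

/-- Hölder's inequality against a power of the Japanese bracket, uniformly in translations. -/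
lemma exists_eLpNorm_jbr_rpow_mul_le {p : ℝ≥0∞} (hp : 2 ≤ p) {δ : ℝ}
    (hδ : 1 / 2 - (1 / p).toReal < δ) :
    ∃ C : ℝ≥0∞, C ≠ ∞ ∧ ∀ (F : ℤ → ℝ) (j : ℤ),
      eLpNorm (fun k : ℤ => jbr k ^ (-δ) * F (k - j)) 2 Measure.count ≤
        C * eLpNorm F p Measure.count := by
  set q : ℝ≥0∞ := (2⁻¹ - p⁻¹)⁻¹ with hq
  have hpi : p⁻¹ ≤ 2⁻¹ := ENNReal.inv_le_inv.2 hp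
  have : ENNReal.HolderTriple q p 2 := ⟨by rw [hq, inv_inv, tsub_add_cancel_of_le hpi]⟩
  have hq0 : q ≠ 0 := by
    rw [hq, ENNReal.inv_ne_zero]
    exact (tsub_le_self.trans_lt (by simp)).ne
  have hqr : q.toReal⁻¹ = 1 / 2 - (1 / p).toReal := by
    rw [← ENNReal.toReal_inv, hq, inv_inv, ENNReal.toReal_sub_of_le hpi (by simp)]
    simp
  have hδ' : q.toReal⁻¹ < δ := hqr ▸ hδ
  have hmem : MemLp (fun k : ℤ => jbr k ^ (-δ)) q Measure.count := by
    refine memLp_jbr_rpow hq0 (le_trans (by positivity) hδ'.le) fun h => ?_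
    rw [mul_comm]
    exact (inv_lt_iff_one_lt_mul₀' (ENNReal.toReal_pos hq0 h)).1 hδ'
  refine ⟨_, hmem.eLpNorm_lt_top.ne, fun F j => ?_⟩
  have htr : eLpNorm (fun k => F (k - j)) p Measure.count = eLpNorm F p Measure.count :=
    eLpNorm_comp_measurePreserving (measurable_of_countable _).aestronglyMeasurable
      (measurePreserving_sub_right Measure.count j)
  rw [← htr]
  exact eLpNorm_smul_le_mul_eLpNorm (p := q) (q := p) (r := 2)
    (f := fun k => F (k - j)) (φ := fun k : ℤ => jbr k ^ (-δ))
    (measurable_of_countable _).aestronglyMeasurable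
    (measurable_of_countable _).aestronglyMeasurable

lemma eLpNorm_count_le_bnorm {s : ℝ} (hs : 0 ≤ s) {p : ℝ≥0∞} (hp : 2 ≤ p) {ξ : ℤ → ℂ}
    (hξ : Memℓp (fun k : ℤ => if k = 0 then (0 : ℝ) else (|k| : ℝ) ^ s * ‖ξ k‖) p) :
    eLpNorm (fun k : ℤ => jbr k ^ s * ‖ξ k‖) p Measure.count ≤
      ENNReal.ofReal (2 ^ s * bnorm s p ξ) := by
  have hp0 : p ≠ 0 := (lt_of_lt_of_le (by norm_num) hp).ne'
  set h : ℤ → ℝ := fun k : ℤ => if k = 0 then (0 : ℝ) else (|k| : ℝ) ^ s * ‖ξ k‖ with hh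
  have hh0 : ∀ k, 0 ≤ h k := fun k => by simp only [hh]; split_ifs <;> positivity
  set A : ℝ := if p = ∞ then ⨆ k : ℤ, h k else (∑' k : ℤ, h k ^ p.toReal) ^ (1 / p.toReal) with hA
  have hb : bnorm s p ξ = ‖ξ 0‖ + A := by
    rw [bnorm, hA]
    congr 1
    split_ifs with hpt
    · rfl
    · congr 2
      ext k
      by_cases hk : k = 0
      · simp [hh, hk, Real.zero_rpow (ENNReal.toReal_pos hp0 hpt).ne']
      · simp [hh, hk]
  have hA0 : 0 ≤ A := by
    rw [hA]
    split_ifs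
    · exact Real.iSup_nonneg hh0
    · exact Real.rpow_nonneg (tsum_nonneg fun k => Real.rpow_nonneg (hh0 k) _) _
  have h1 : eLpNorm h p Measure.count ≤ ENNReal.ofReal A := by
    by_cases hpt : p = ∞
    · subst hpt
      rw [hA, if_pos rfl, eLpNorm_exponent_top]
      refine eLpNormEssSup_le_of_ae_bound (.of_forall fun k => ?_)
      rw [Real.norm_of_nonneg (hh0 k)]
      refine le_ciSup (f := h) ?_ k
      simpa [abs_of_nonneg (hh0 _)] using memℓp_infty_iff.1 hξ
    · have hpr : 0 < p.toReal := ENNReal.toReal_pos hp0 hpt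
      have hsum : Summable fun k => h k ^ p.toReal := by
        simpa [abs_of_nonneg (hh0 _)] using hξ.summable hpr
      rw [hA, if_neg hpt, eLpNorm_eq_lintegral_rpow_enorm_toReal hp0 hpt, lintegral_count,
        ← ENNReal.ofReal_rpow_of_nonneg (tsum_nonneg fun k => Real.rpow_nonneg (hh0 k) _)
          (by positivity),
        ENNReal.ofReal_tsum_of_nonneg (fun k => Real.rpow_nonneg (hh0 k) _) hsum]
      refine le_of_eq ?_
      congr 2
      ext k
      rw [← ENNReal.ofReal_rpow_of_nonneg (hh0 k) hpr.le, Real.enorm_of_nonneg (hh0 k)]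
  have h2 : eLpNorm (Set.indicator {(0 : ℤ)} fun _ => ‖ξ 0‖) p Measure.count ≤
      ENNReal.ofReal ‖ξ 0‖ := by
    refine (eLpNorm_indicator_const_le _ _).trans ?_
    simp
  have h3 : eLpNorm (fun k : ℤ => jbr k ^ s * ‖ξ k‖) p Measure.count ≤
      ENNReal.ofReal (2 ^ s) *
        eLpNorm ((Set.indicator {(0 : ℤ)} fun _ => ‖ξ 0‖) + h) p Measure.count := by
    refine eLpNorm_le_mul_eLpNorm_of_ae_le_mul (.of_forall fun k => ?_) p
    have h2s : (1 : ℝ) ≤ 2 ^ s := Real.one_le_rpow (by norm_num) hs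
    rw [Real.norm_of_nonneg (mul_nonneg (Real.rpow_nonneg (jbr_pos k).le _) (norm_nonneg _))]
    by_cases hk : k = 0
    · subst hk
      have : jbr 0 = 1 := by simp [jbr]
      simp only [this, hh, Pi.add_apply]
      simpa using le_mul_of_one_le_left (norm_nonneg (ξ 0)) h2s
    · have hz : 0 ≤ |(k : ℝ)| ^ s * ‖ξ k‖ := by positivity
      simp only [hh, Pi.add_apply, hk, if_false, Set.indicator, Set.mem_singleton_iff, zero_add]
      rw [Real.norm_of_nonneg hz, ← mul_assoc, ← Real.mul_rpow (by norm_num) (abs_nonneg _)]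
      gcongr
      · exact (jbr_pos k).le
      · exact jbr_le_two_mul_abs hk
  refine h3.trans ?_
  rw [hb, ENNReal.ofReal_mul (by positivity), ENNReal.ofReal_add (norm_nonneg _) hA0]
  gcongr
  refine (eLpNorm_add_le (measurable_of_countable _).aestronglyMeasurable
    (measurable_of_countable _).aestronglyMeasurable
    (le_trans (by norm_num) hp)).trans (add_le_add h2 h1)

lemma ENNReal.tsum_mul_sq_le {ι : Type*} [Countable ι] (f g : ι → ℝ≥0∞) :
    (∑' i, f i * g i) ^ 2 ≤ (∑' i, f i ^ 2) * ∑' i, g i ^ 2 := by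
  let _ : MeasurableSpace ι := ⊤
  have h := ENNReal.lintegral_mul_le_Lp_mul_Lq (Measure.count (α := ι)) Real.HolderConjugate.two_two
    (measurable_from_top (f := f)).aemeasurable (measurable_from_top (f := g)).aemeasurable
  simp only [lintegral_count, Pi.mul_apply, ENNReal.rpow_ofNat] at h
  calc _ ≤ _ := pow_le_pow_left' h 2
    _ = _ := by
      rw [mul_pow, ← ENNReal.rpow_natCast, ← ENNReal.rpow_natCast, ← ENNReal.rpow_mul,
        ← ENNReal.rpow_mul]
      simp

/-- Weighted Cauchy–Schwarz inequality. -/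
lemma ENNReal.tsum_mul_sq_le_weight {ι : Type*} [Countable ι] (g f : ι → ℝ≥0∞) :
    (∑' i, g i * f i) ^ 2 ≤ (∑' i, g i) * ∑' i, g i * f i ^ 2 := by
  have hg : ∀ i, (g i ^ (1 / 2 : ℝ)) ^ 2 = g i := fun i => by
    rw [← ENNReal.rpow_natCast, ← ENNReal.rpow_mul]; simp
  have h := ENNReal.tsum_mul_sq_le (fun i => g i ^ (1 / 2 : ℝ)) fun i => g i ^ (1 / 2 : ℝ) * f i
  simpa only [mul_pow, hg, ← mul_assoc, ← sq] using h

/-- Convolution with a summable sequence is bounded by translates in a weighted `ℓ²` space. -/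
lemma tsum_sq_weight_mul_conv_le {V F G : ℤ → ℝ≥0∞} {M : ℝ≥0∞}
    (hM : ∀ j, ∑' k, (V k * F (k - j)) ^ 2 ≤ M) :
    ∑' k, (V k * ∑' j, G j * F (k - j)) ^ 2 ≤ (∑' j, G j) ^ 2 * M := by
  calc ∑' k, (V k * ∑' j, G j * F (k - j)) ^ 2
      = ∑' k, (∑' j, G j * (V k * F (k - j))) ^ 2 := by
        simp only [← ENNReal.tsum_mul_left, mul_left_comm]
    _ ≤ ∑' k, (∑' j, G j) * ∑' j, G j * (V k * F (k - j)) ^ 2 :=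
        ENNReal.tsum_le_tsum fun k => ENNReal.tsum_mul_sq_le_weight _ _
    _ = (∑' j, G j) * ∑' j, G j * ∑' k, (V k * F (k - j)) ^ 2 := by
        rw [ENNReal.tsum_mul_left, ENNReal.tsum_comm]
        simp only [ENNReal.tsum_mul_left]
    _ ≤ (∑' j, G j) * ∑' j, G j * M := by
        gcongr with j
        exact hM j
    _ = (∑' j, G j) ^ 2 * M := by
        rw [ENNReal.tsum_mul_right, sq, mul_assoc]

lemma jbr_rpow_le_max (e : ℝ) {N : ℝ} (hN : 1 ≤ N) {k : ℤ} (hk : |(k : ℝ)| ≤ N) :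
    jbr k ^ e ≤ 2 ^ |e| * max (N ^ e) 1 := by
  rcases le_or_gt 0 e with he | he
  · calc jbr k ^ e ≤ (2 * N) ^ e :=
          Real.rpow_le_rpow (jbr_pos k).le (jbr_le_two_mul hN hk) he
      _ = 2 ^ |e| * N ^ e := by rw [Real.mul_rpow (by norm_num) (by linarith), abs_of_nonneg he]
      _ ≤ _ := by gcongr; exact le_max_left _ _
  · calc jbr k ^ e ≤ 1 := Real.rpow_le_one_of_one_le_of_nonpos (one_le_jbr k) he.le
      _ ≤ 2 ^ |e| * max (N ^ e) 1 :=
          one_le_mul_of_one_le_of_one_le (Real.one_le_rpow (by norm_num) (abs_nonneg e))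
            (le_max_right _ _)

lemma jbr_rpow_le_mul {s β δ N : ℝ} (hs : 0 ≤ s) (hN : 1 ≤ N) {k : ℤ} (hk : |(k : ℝ)| ≤ N)
    (j : ℤ) :
    jbr k ^ β ≤ 2 ^ |β - s + δ| * max (N ^ (β - s + δ)) 1 * 2 ^ s *
      (jbr k ^ (-δ) * (jbr j ^ s * jbr (k - j) ^ s)) := by
  have h1 : jbr k ^ s ≤ 2 ^ s * (jbr j ^ s * jbr (k - j) ^ s) := by
    rw [← Real.mul_rpow (jbr_pos _).le (jbr_pos _).le,
      ← Real.mul_rpow (by norm_num) (mul_nonneg (jbr_pos _).le (jbr_pos _).le)]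
    exact Real.rpow_le_rpow (jbr_pos k).le (by simpa using jbr_add_le j (k - j)) hs
  have hδ : 0 ≤ jbr k ^ (-δ) := Real.rpow_nonneg (jbr_pos k).le _
  calc jbr k ^ β = jbr k ^ (β - s + δ) * (jbr k ^ (-δ) * jbr k ^ s) := by
        rw [← Real.rpow_add (jbr_pos k), ← Real.rpow_add (jbr_pos k)]; congr 1; ring
    _ ≤ (2 ^ |β - s + δ| * max (N ^ (β - s + δ)) 1) *
        (jbr k ^ (-δ) * (2 ^ s * (jbr j ^ s * jbr (k - j) ^ s))) :=
        mul_le_mul (jbr_rpow_le_max _ hN hk) (mul_le_mul_of_nonneg_left h1 hδ)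
          (mul_nonneg hδ (Real.rpow_nonneg (jbr_pos k).le _)) (by positivity)
    _ = _ := by ring

/-- The pointwise bound of a frequency-localized product by a weighted convolution. -/
lemma ofReal_jbr_mul_norm_conv_le {s β δ N : ℝ} (hs : 0 ≤ s) (hN : 1 ≤ N) {k : ℤ}
    (hk : |(k : ℝ)| ≤ N) (ξ w : ℤ → ℂ) :
    ENNReal.ofReal (jbr k ^ β * ‖∑' l : ℤ, ξ l * w (k - l)‖) ≤
      ENNReal.ofReal (2 ^ |β - s + δ| * max (N ^ (β - s + δ)) 1 * 2 ^ s) *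
        (ENNReal.ofReal (jbr k ^ (-δ)) * ∑' j : ℤ, ENNReal.ofReal (jbr j ^ s * ‖w j‖) *
          ENNReal.ofReal (jbr (k - j) ^ s * ‖ξ (k - j)‖)) := by
  have hr : ∀ (m : ℤ) (t : ℝ), 0 ≤ jbr m ^ t := fun m t => Real.rpow_nonneg (jbr_pos m).le t
  have hconv : ‖∑' l : ℤ, ξ l * w (k - l)‖ₑ ≤ ∑' j : ℤ, ‖w j‖ₑ * ‖ξ (k - j)‖ₑ := by
    refine enorm_tsum_le_tsum_enorm.trans (le_of_eq ?_)
    rw [← (Equiv.subLeft k).tsum_eq]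
    exact tsum_congr fun j => by simp [enorm_mul, mul_comm]
  rw [ENNReal.ofReal_mul (hr _ _), ofReal_norm]
  refine (mul_le_mul_right hconv _).trans ?_
  rw [← ENNReal.tsum_mul_left, ← ENNReal.tsum_mul_left, ← ENNReal.tsum_mul_left]
  refine ENNReal.tsum_le_tsum fun j => ?_
  simp only [← ofReal_norm]
  rw [← ENNReal.ofReal_mul (norm_nonneg _), ← ENNReal.ofReal_mul (hr _ _),
    ← ENNReal.ofReal_mul (mul_nonneg (hr _ _) (norm_nonneg _)), ← ENNReal.ofReal_mul (hr _ _),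
    ← ENNReal.ofReal_mul (by positivity)]
  refine ENNReal.ofReal_le_ofReal ?_
  refine (mul_le_mul_of_nonneg_right (jbr_rpow_le_mul (δ := δ) hs hN hk j)
    (by positivity)).trans (le_of_eq (by ring))

lemma tsum_ofReal_jbr_mul_sq_le {s a : ℝ} (ha : 1 < 2 * (a - s)) {w : ℤ → ℂ}
    (hw : Summable fun k : ℤ => jbr k ^ (2 * a) * ‖w k‖ ^ 2) :
    (∑' j : ℤ, ENNReal.ofReal (jbr j ^ s * ‖w j‖)) ^ 2 ≤
      ENNReal.ofReal ((∑' j : ℤ, jbr j ^ (-(2 * (a - s)))) *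
        ∑' j : ℤ, jbr j ^ (2 * a) * ‖w j‖ ^ 2) := by
  have hr : ∀ (m : ℤ) (t : ℝ), 0 ≤ jbr m ^ t := fun m t => Real.rpow_nonneg (jbr_pos m).le t
  have h := ENNReal.tsum_mul_sq_le (fun j : ℤ => ENNReal.ofReal (jbr j ^ (-(a - s))))
    fun j => ENNReal.ofReal (jbr j ^ a * ‖w j‖)
  have e1 : ∀ (j : ℤ), jbr j ^ s = jbr j ^ (-(a - s)) * jbr j ^ a := fun j => by
    rw [← Real.rpow_add (jbr_pos j)]; congr 1; ring
  have e2 : ∀ (j : ℤ) (t : ℝ), (jbr j ^ t) ^ 2 = jbr j ^ (2 * t) := fun j t => by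
    rw [← Real.rpow_natCast, ← Real.rpow_mul (jbr_pos j).le, mul_comm t]; norm_num
  rw [ENNReal.ofReal_mul (tsum_nonneg fun j => hr j _),
    ENNReal.ofReal_tsum_of_nonneg (fun j => hr j _) (summable_jbr_rpow ha),
    ENNReal.ofReal_tsum_of_nonneg (fun j => mul_nonneg (hr j _) (sq_nonneg _)) hw]
  convert h using 4 with j j j
  · rw [← ENNReal.ofReal_mul (hr _ _), e1, mul_assoc]
  · rw [← ENNReal.ofReal_pow (hr _ _), e2]; congr 2; ring
  · rw [← ENNReal.ofReal_pow (mul_nonneg (hr _ _) (norm_nonneg _)), mul_pow, e2]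

lemma ENNReal.ofReal_tsum_le {ι : Type*} {f : ι → ℝ} (hf : ∀ i, 0 ≤ f i) :
    ENNReal.ofReal (∑' i, f i) ≤ ∑' i, ENNReal.ofReal (f i) := by
  by_cases h : Summable f
  · rw [ENNReal.ofReal_tsum_of_nonneg hf h]
  · simp [tsum_eq_zero_of_not_summable h]

lemma bnorm_nonneg (s : ℝ) (p : ℝ≥0∞) (ξ : ℤ → ℂ) : 0 ≤ bnorm s p ξ := by
  refine add_nonneg (norm_nonneg _) ?_
  split_ifs
  · exact Real.iSup_nonneg fun k => by split_ifs <;> positivity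
  · exact Real.rpow_nonneg (tsum_nonneg fun k => by split_ifs <;> positivity) _

/-- Frequency-localized bilinear estimate for rough potentials (core of Lemma 5.3,
combining (est:I11) and (est:I12)): for `s ≥ 0`, `2 ≤ p ≤ ∞`, `γ_p = 3/2 + 1/p`,
`ε ∈ (0,1/2)` and `0 ≤ β < s + γ_p − ε`, there is `C > 0` such that for all `N₀ ≥ 1`,
`ξ̂ ∈ b̂^{s,p}` and `w ∈ h^{s+γ_p−ε}`,
`‖P_{≤N₀}(ξ w)‖_{H^β} ≤ C max{N₀^{β−s−1/p+1/2+ε}, 1} ‖ξ̂‖_{b̂^{s,p}} ‖w‖_{h^{s+γ_p−ε}}`. -/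
theorem freq_localized_bilinear_estimate (s : ℝ) (hs : 0 ≤ s) (p : ℝ≥0∞) (hp : 2 ≤ p)
    (ε β : ℝ) (hε0 : 0 < ε) (hε1 : ε < 1 / 2) (hβ0 : 0 ≤ β)
    (hβ1 : β < s + (3 / 2 + (1 / p).toReal) - ε) :
    ∃ C > 0, ∀ N₀ : ℝ, 1 ≤ N₀ →
      ∀ ξ : ℤ → ℂ, Memℓp (fun k : ℤ => if k = 0 then (0 : ℝ) else (|k| : ℝ) ^ s * ‖ξ k‖) p →
      ∀ w : ℤ → ℂ,
        Summable (fun k : ℤ =>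
          jbr k ^ (2 * (s + (3 / 2 + (1 / p).toReal) - ε)) * ‖w k‖ ^ 2) →
        (∑' k : ℤ, Set.indicator {k : ℤ | (|k| : ℝ) ≤ N₀}
            (fun k => jbr k ^ (2 * β) * ‖∑' k₁ : ℤ, ξ k₁ * w (k - k₁)‖ ^ 2) k) ^ ((1 : ℝ) / 2) ≤
          C * max (N₀ ^ (β - s - (1 / p).toReal + 1 / 2 + ε)) 1 * bnorm s p ξ *
            (∑' k : ℤ,
              jbr k ^ (2 * (s + (3 / 2 + (1 / p).toReal) - ε)) * ‖w k‖ ^ 2) ^ ((1 : ℝ) / 2) := by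
  set θ := (1 / p).toReal with hθ
  have hθ0 : 0 ≤ θ := ENNReal.toReal_nonneg
  set δ : ℝ := 1 / 2 - θ + ε with hδ
  set a : ℝ := s + (3 / 2 + θ) - ε with ha
  have hr : ∀ (m : ℤ) (t : ℝ), 0 ≤ jbr m ^ t := fun m t => Real.rpow_nonneg (jbr_pos m).le t
  obtain ⟨C, hC, hHolder⟩ := exists_eLpNorm_jbr_rpow_mul_le hp (δ := δ) (by linarith)
  set D : ℝ := ∑' j : ℤ, jbr j ^ (-(2 * (a - s)))
  have hD : 0 ≤ D := tsum_nonneg fun j => hr j _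
  refine ⟨2 ^ |β - s + δ| * 2 ^ s * √D * C.toReal * 2 ^ s + 1, by positivity,
    fun N hN ξ hξ w hw => ?_⟩
  have hexp : β - s - θ + 1 / 2 + ε = β - s + δ := by rw [hδ]; ring
  rw [hexp]
  set m : ℝ := max (N ^ (β - s + δ)) 1
  set W : ℝ := ∑' k : ℤ, jbr k ^ (2 * a) * ‖w k‖ ^ 2
  have hW : 0 ≤ W := tsum_nonneg fun k => mul_nonneg (hr k _) (sq_nonneg _)
  have hm : 0 ≤ m := zero_le_one.trans (le_max_right _ _)
  have hB := bnorm_nonneg s p ξ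
  set B := bnorm s p ξ
  set K : ℝ := 2 ^ |β - s + δ| * m * 2 ^ s with hK
  have hK0 : 0 ≤ K := by positivity
  have htranslate : ∀ j : ℤ, ∑' k : ℤ, (ENNReal.ofReal (jbr k ^ (-δ)) *
      ENNReal.ofReal (jbr (k - j) ^ s * ‖ξ (k - j)‖)) ^ 2 ≤
      ENNReal.ofReal ((C.toReal * (2 ^ s * B)) ^ 2) := by
    intro j
    have h := (hHolder (fun k => jbr k ^ s * ‖ξ k‖) j).trans
      (mul_le_mul_right (eLpNorm_count_le_bnorm hs hp hξ) C)
    rw [eLpNorm_eq_lintegral_rpow_enorm_toReal (by norm_num) (by norm_num), lintegral_count] at h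
    have h' := pow_le_pow_left' h 2
    rw [← ENNReal.rpow_natCast, ← ENNReal.rpow_mul] at h'
    rw [ENNReal.ofReal_pow (by positivity), ENNReal.ofReal_mul ENNReal.toReal_nonneg,
      ENNReal.ofReal_toReal hC]
    refine le_trans (le_of_eq ?_) h'
    simp only [ENNReal.toReal_ofNat, one_div, Nat.cast_ofNat, isUnit_iff_ne_zero, ne_eq,
      OfNat.ofNat_ne_zero, not_false_eq_true, IsUnit.inv_mul_cancel, ENNReal.rpow_one,
      ENNReal.rpow_ofNat]
    refine tsum_congr fun k => ?_
    rw [Real.enorm_of_nonneg (mul_nonneg (hr _ _) (mul_nonneg (hr _ _) (norm_nonneg _))),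
      ENNReal.ofReal_mul (hr k (-δ))]
  set S : ℝ := ∑' k : ℤ, Set.indicator {k : ℤ | (|k| : ℝ) ≤ N}
    (fun k => jbr k ^ (2 * β) * ‖∑' k₁ : ℤ, ξ k₁ * w (k - k₁)‖ ^ 2) k with hS
  have hind : ∀ k : ℤ, 0 ≤ Set.indicator {k : ℤ | (|k| : ℝ) ≤ N}
      (fun k => jbr k ^ (2 * β) * ‖∑' k₁ : ℤ, ξ k₁ * w (k - k₁)‖ ^ 2) k := fun k =>
    Set.indicator_nonneg (fun k _ => mul_nonneg (hr _ _) (sq_nonneg _)) k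
  have hS0 : 0 ≤ S := tsum_nonneg hind
  have hmain : ENNReal.ofReal S ≤
      ENNReal.ofReal (K ^ 2 * ((D * W) * (C.toReal * (2 ^ s * B)) ^ 2)) := by
    calc ENNReal.ofReal S
        ≤ ∑' k : ℤ, ENNReal.ofReal (Set.indicator {k : ℤ | (|k| : ℝ) ≤ N}
            (fun k => jbr k ^ (2 * β) * ‖∑' k₁ : ℤ, ξ k₁ * w (k - k₁)‖ ^ 2) k) :=
          ENNReal.ofReal_tsum_le hind
      _ ≤ ∑' k : ℤ, ENNReal.ofReal K ^ 2 * (ENNReal.ofReal (jbr k ^ (-δ)) *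
            ∑' j : ℤ, ENNReal.ofReal (jbr j ^ s * ‖w j‖) *
              ENNReal.ofReal (jbr (k - j) ^ s * ‖ξ (k - j)‖)) ^ 2 := by
          refine ENNReal.tsum_le_tsum fun k => ?_
          by_cases hk : |(k : ℝ)| ≤ N
          · rw [Set.indicator_of_mem (by exact hk), ← mul_pow]
            have e : jbr k ^ (2 * β) = (jbr k ^ β) ^ 2 := by
              rw [← Real.rpow_natCast, ← Real.rpow_mul (jbr_pos k).le, mul_comm 2]; norm_num
            rw [e, ← mul_pow, ENNReal.ofReal_pow (mul_nonneg (hr _ _) (norm_nonneg _))]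
            exact pow_le_pow_left' (ofReal_jbr_mul_norm_conv_le hs hN hk ξ w) 2
          · rw [Set.indicator_of_notMem (by exact hk)]
            simp
      _ ≤ ENNReal.ofReal K ^ 2 * (ENNReal.ofReal (D * W) *
            ENNReal.ofReal ((C.toReal * (2 ^ s * B)) ^ 2)) := by
          rw [ENNReal.tsum_mul_left]
          refine mul_le_mul_right ((tsum_sq_weight_mul_conv_le
            (V := fun k => ENNReal.ofReal (jbr k ^ (-δ)))
            (F := fun k => ENNReal.ofReal (jbr k ^ s * ‖ξ k‖)) htranslate).trans
            (mul_le_mul_left (tsum_ofReal_jbr_mul_sq_le (a := a) ?_ hw) _)) _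
          rw [ha]; linarith
      _ = _ := by
          rw [← ENNReal.ofReal_pow hK0, ← ENNReal.ofReal_mul (by positivity),
            ← ENNReal.ofReal_mul (by positivity)]
  rw [ENNReal.ofReal_le_ofReal_iff (by positivity)] at hmain
  rw [← Real.sqrt_eq_rpow, ← Real.sqrt_eq_rpow]
  calc √S ≤ √(K ^ 2 * ((D * W) * (C.toReal * (2 ^ s * B)) ^ 2)) := Real.sqrt_le_sqrt hmain
    _ = K * (√D * √W * (C.toReal * (2 ^ s * B))) := by
        rw [Real.sqrt_mul (by positivity), Real.sqrt_mul (by positivity), Real.sqrt_mul hD,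
          Real.sqrt_sq hK0, Real.sqrt_sq (by positivity)]
    _ = (2 ^ |β - s + δ| * 2 ^ s * √D * C.toReal * 2 ^ s) * m * B * √W := by rw [hK]; ring
    _ ≤ _ := by gcongr; linarith
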